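/- arXiv:1711.02354 — 5 statements merged into one kernel-verified Lean document; each statement's English description precedes it below -/
import Mathlib

section
/- Let n ≥ 1 and let A, B ∈ M_n(ℂ). The matrices A and B have a common eigenvector if and only if the subspace M = ⋂_{k=1}^{n-1} ⋂_{l=1}^{n-1} ker [A^k, B^l] is nonzero, where [X, Y] = XY − YX denotes the matrix commutator. -/
open Polynomial in
/-- Every power of a square matrix lies in the span of the powers below its size. -/
theorem Matrix.pow_mem_span_pow_lt {R : Type*} [CommRing R] [Nontrivial R] {n : ℕ}
    (A : Matrix (Fin n) (Fin n) R) (k : ℕ) :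
    A ^ k ∈ Submodule.span R ((fun i : ℕ => A ^ i) '' Set.Iio n) := by
  rw [A.pow_eq_aeval_mod_charpoly k, aeval_eq_sum_range]
  refine Submodule.sum_mem _ fun i _ => ?_
  by_cases hi : i < n
  · exact Submodule.smul_mem _ _ (Submodule.subset_span ⟨i, hi, rfl⟩)
  · have hdeg : ((X ^ k : R[X]) %ₘ A.charpoly).degree < i := by
      refine (degree_modByMonic_lt _ A.charpoly_monic).trans_le ?_
      rw [A.charpoly_degree_eq_dim, Fintype.card_fin]
      exact_mod_cast not_lt.mp hi
    rw [coeff_eq_zero_of_degree_lt hdeg, zero_smul]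
    exact Submodule.zero_mem _

open Matrix in
/-- If all powers `A ^ i` with `1 ≤ i ≤ n - 1` commute with `C` on `v`, then so do all powers. -/
theorem Matrix.pow_mulVec_comm_of_forall_lt {R : Type*} [CommRing R] [Nontrivial R] {n : ℕ}
    {A C : Matrix (Fin n) (Fin n) R} {v : Fin n → R}
    (h : ∀ i, 1 ≤ i → i ≤ n - 1 → A ^ i *ᵥ C *ᵥ v = C *ᵥ A ^ i *ᵥ v) (k : ℕ) :
    A ^ k *ᵥ C *ᵥ v = C *ᵥ A ^ k *ᵥ v := by
  have hk := A.pow_mem_span_pow_lt k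
  generalize A ^ k = Y at hk ⊢
  induction hk using Submodule.span_induction with
  | mem X hX =>
    obtain ⟨i, hi, rfl⟩ := hX
    rcases Nat.eq_zero_or_pos i with rfl | hpos
    · simp
    · exact h i hpos (Nat.le_sub_one_of_lt hi)
  | zero => simp
  | add X Y _ _ hX hY => rw [add_mulVec, add_mulVec, mulVec_add, hX, hY]
  | smul c X _ hX => rw [smul_mulVec, smul_mulVec, mulVec_smul, hX]

/-- An invariant nonzero subspace contains an eigenvector. -/
theorem Module.End.exists_eigenvector_mem_of_invariant {K V : Type*} [Field K] [IsAlgClosed K]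
    [AddCommGroup V] [Module K V] [FiniteDimensional K V] (f : Module.End K V)
    {N : Submodule K V} (hN : N ≠ ⊥) (hf : ∀ v ∈ N, f v ∈ N) :
    ∃ v ∈ N, v ≠ 0 ∧ ∃ μ : K, f v = μ • v := by
  have := (Submodule.nontrivial_iff_ne_bot).mpr hN
  obtain ⟨μ, hμ⟩ := Module.End.exists_eigenvalue (f.restrict hf)
  obtain ⟨v, hv⟩ := hμ.exists_hasEigenvector
  exact ⟨v, v.2, fun h => hv.2 (Subtype.ext h), μ, congrArg Subtype.val hv.apply_eq_smul⟩

/-- Two endomorphisms that commute on a nonzero subspace invariant under both have a common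
eigenvector in it. -/
theorem Module.End.exists_common_eigenvector_mem {K V : Type*} [Field K] [IsAlgClosed K]
    [AddCommGroup V] [Module K V] [FiniteDimensional K V] (f g : Module.End K V)
    {N : Submodule K V} (hN : N ≠ ⊥) (hf : ∀ v ∈ N, f v ∈ N) (hg : ∀ v ∈ N, g v ∈ N)
    (hfg : ∀ v ∈ N, f (g v) = g (f v)) :
    ∃ v ∈ N, v ≠ 0 ∧ (∃ α : K, f v = α • v) ∧ ∃ β : K, g v = β • v := by
  obtain ⟨v, hvN, hv0, α, hα⟩ := f.exists_eigenvector_mem_of_invariant hN hf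
  have hne : N ⊓ f.eigenspace α ≠ ⊥ :=
    (Submodule.ne_bot_iff _).mpr ⟨v, ⟨hvN, Module.End.mem_eigenspace_iff.mpr hα⟩, hv0⟩
  obtain ⟨w, hw, hw0, β, hβ⟩ := g.exists_eigenvector_mem_of_invariant hne fun w hw =>
    ⟨hg w hw.1, Module.End.mem_eigenspace_iff.mpr <| by
      rw [hfg w hw.1, Module.End.mem_eigenspace_iff.mp hw.2, map_smul]⟩
  exact ⟨w, hw.1, hw0, ⟨α, Module.End.mem_eigenspace_iff.mp hw.2⟩, β, hβ⟩

open Matrix in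
theorem Matrix.pow_mulVec_of_mulVec_eq_smul {R ι : Type*} [CommRing R] [Fintype ι] [DecidableEq ι]
    {A : Matrix ι ι R} {v : ι → R} {α : R} (h : A *ᵥ v = α • v) (k : ℕ) :
    A ^ k *ᵥ v = α ^ k • v := by
  induction k with
  | zero => simp
  | succ k ih => rw [pow_succ, ← mulVec_mulVec, h, mulVec_smul, ih, smul_smul, pow_succ']

open Matrix in
/-- The common kernel of the commutators `[A ^ k, B ^ l]`, `1 ≤ k, l ≤ n - 1`, consists of the
vectors on which all powers of `A` commute with all powers of `B`. -/
theorem Matrix.mem_iInf_ker_commutator_pow_iff {R : Type*} [CommRing R] [Nontrivial R] {n : ℕ}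
    {A B : Matrix (Fin n) (Fin n) R} {v : Fin n → R} :
    v ∈ (⨅ k ∈ Finset.Icc 1 (n - 1), ⨅ l ∈ Finset.Icc 1 (n - 1),
        LinearMap.ker (A ^ k * B ^ l - B ^ l * A ^ k).mulVecLin) ↔
      ∀ k l : ℕ, A ^ k *ᵥ B ^ l *ᵥ v = B ^ l *ᵥ A ^ k *ᵥ v := by
  simp only [Submodule.mem_iInf, Finset.mem_Icc, LinearMap.mem_ker, mulVecLin_apply, sub_mulVec,
    ← mulVec_mulVec, sub_eq_zero]
  refine ⟨fun h k l => ?_, fun h k _ l _ => h k l⟩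
  refine pow_mulVec_comm_of_forall_lt (fun i hi hi' => ?_) k
  exact (pow_mulVec_comm_of_forall_lt (fun j hj hj' => (h i ⟨hi, hi'⟩ j ⟨hj, hj'⟩).symm) l).symm

/-- **Shemesh theorem.** Matrices `A, B ∈ M_n(ℂ)` have a common eigenvector if and only if
the subspace `M = ⋂_{k,l=1}^{n-1} ker [A^k, B^l]` is nonzero. -/
theorem shemesh (n : ℕ) (hn : 1 ≤ n) (A B : Matrix (Fin n) (Fin n) ℂ) :
    (∃ v : Fin n → ℂ, v ≠ 0 ∧ (∃ α : ℂ, A.mulVec v = α • v) ∧ (∃ β : ℂ, B.mulVec v = β • v)) ↔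
      (⨅ k ∈ Finset.Icc 1 (n - 1), ⨅ l ∈ Finset.Icc 1 (n - 1),
        LinearMap.ker (A ^ k * B ^ l - B ^ l * A ^ k).mulVecLin) ≠ ⊥ := by
  constructor
  · rintro ⟨v, hv0, ⟨α, hα⟩, β, hβ⟩
    refine (Submodule.ne_bot_iff _).mpr
      ⟨v, Matrix.mem_iInf_ker_commutator_pow_iff.mpr fun k l => ?_, hv0⟩
    rw [Matrix.pow_mulVec_of_mulVec_eq_smul hα, Matrix.pow_mulVec_of_mulVec_eq_smul hβ,
      Matrix.mulVec_smul, Matrix.mulVec_smul, Matrix.pow_mulVec_of_mulVec_eq_smul hα,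
      Matrix.pow_mulVec_of_mulVec_eq_smul hβ, smul_comm]
  · intro hM
    refine (Module.End.exists_common_eigenvector_mem A.mulVecLin B.mulVecLin hM
      (fun v hv => ?_) (fun v hv => ?_) (fun v hv => ?_)).imp fun v hv => hv.2
    · rw [Matrix.mem_iInf_ker_commutator_pow_iff] at hv ⊢
      intro k l
      have hA := hv 1 l
      have hAk := hv (k + 1) l
      rw [pow_one] at hA
      rw [pow_succ, ← Matrix.mulVec_mulVec, ← Matrix.mulVec_mulVec] at hAk
      rw [Matrix.mulVecLin_apply, ← hA, hAk]
    · rw [Matrix.mem_iInf_ker_commutator_pow_iff] at hv ⊢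
      intro k l
      have hB := hv k 1
      have hBl := hv k (l + 1)
      rw [pow_one] at hB
      rw [pow_succ, ← Matrix.mulVec_mulVec, ← Matrix.mulVec_mulVec] at hBl
      rw [Matrix.mulVecLin_apply, hB, hBl]
    · simpa using Matrix.mem_iInf_ker_commutator_pow_iff.mp hv 1 1
end

section
/- Let n ≥ 1, let A, B ∈ M_n(ℂ), and let M = ⋂_{k=1}^{n-1} ⋂_{l=1}^{n-1} ker [A^k, B^l]. Then: (i) M is invariant under A and under B (A(M) ⊆ M and B(M) ⊆ M); (ii) A and B commute on M, i.e. ABx = BAx for every x ∈ M; and (iii) every common eigenvector of A and B belongs to M. -/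
namespace Matrix

variable {ι R : Type*} [Fintype ι] [CommRing R]

/-- By the Cayley–Hamilton theorem, a submodule containing the powers of `A` below the size of `A`
contains all powers of `A`. -/
theorem pow_mem_of_forall_lt_card [DecidableEq ι] [Nontrivial R] (A : Matrix ι ι R)
    (S : Submodule R (Matrix ι ι R)) (h : ∀ k < Fintype.card ι, A ^ k ∈ S) (k : ℕ) :
    A ^ k ∈ S := by
  rw [A.pow_eq_aeval_mod_charpoly k, Polynomial.aeval_eq_sum_range]
  refine S.sum_mem fun i _ => ?_
  by_cases hi : i < Fintype.card ι
  · exact S.smul_mem _ (h i hi)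
  · rw [Polynomial.coeff_eq_zero_of_degree_lt, zero_smul]
    · exact S.zero_mem
    · refine (Polynomial.degree_modByMonic_lt _ A.charpoly_monic).trans_le ?_
      rw [A.charpoly_degree_eq_dim]
      exact_mod_cast not_lt.mp hi

/-- The submodule of matrices that commute with `C` on the vector `x`. -/
def commutingAt (C : Matrix ι ι R) (x : ι → R) : Submodule R (Matrix ι ι R) where
  carrier := {D | D *ᵥ C *ᵥ x = C *ᵥ D *ᵥ x}
  zero_mem' := by simp
  add_mem' {D E} hD hE := by
    simp only [Set.mem_ofPred_eq] at hD hE ⊢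
    rw [add_mulVec, add_mulVec, mulVec_add, hD, hE]
  smul_mem' c D hD := by
    simp only [Set.mem_ofPred_eq] at hD ⊢
    rw [smul_mulVec, smul_mulVec, mulVec_smul, hD]

theorem mem_commutingAt {C D : Matrix ι ι R} {x : ι → R} :
    D ∈ commutingAt C x ↔ D *ᵥ C *ᵥ x = C *ᵥ D *ᵥ x :=
  Iff.rfl

theorem mem_commutingAt_comm {C D : Matrix ι ι R} {x : ι → R} :
    D ∈ commutingAt C x ↔ C ∈ commutingAt D x :=
  eq_comm

theorem pow_mem_commutingAt_pow [DecidableEq ι] [Nontrivial R] {A B : Matrix ι ι R} {x : ι → R}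
    (h : ∀ k < Fintype.card ι, ∀ l < Fintype.card ι, A ^ k ∈ commutingAt (B ^ l) x) (k l : ℕ) :
    A ^ k ∈ commutingAt (B ^ l) x := by
  refine pow_mem_of_forall_lt_card A _ (fun i hi => ?_) k
  rw [mem_commutingAt_comm]
  refine pow_mem_of_forall_lt_card B _ (fun j hj => ?_) l
  exact mem_commutingAt_comm.mp (h i hi j hj)

theorem pow_mem_commutingAt_pow_mulVec [DecidableEq ι] {A B : Matrix ι ι R} {x : ι → R}
    (h : ∀ k l : ℕ, A ^ k ∈ commutingAt (B ^ l) x) (k l : ℕ) :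
    A ^ k ∈ commutingAt (B ^ l) (A *ᵥ x) := by
  have hl := h 1 l
  have hkl := h (k + 1) l
  simp only [mem_commutingAt, pow_one] at hl hkl ⊢
  rw [← hl, mulVec_mulVec, ← pow_succ, hkl, pow_succ, ← mulVec_mulVec]

theorem pow_mulVec_of_mulVec_eq_smul_s1 [DecidableEq ι] {A : Matrix ι ι R} {v : ι → R} {a : R}
    (h : A *ᵥ v = a • v) (k : ℕ) : (A ^ k) *ᵥ v = a ^ k • v := by
  induction k with
  | zero => simp
  | succ k ih => rw [pow_succ, ← mulVec_mulVec, h, mulVec_smul, ih, smul_smul, pow_succ']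

end Matrix

open Matrix in
theorem mem_shemesh_subspace_iff {n : ℕ} {A B : Matrix (Fin n) (Fin n) ℂ} {x : Fin n → ℂ} :
    x ∈ (⨅ k ∈ Finset.Icc 1 (n - 1), ⨅ l ∈ Finset.Icc 1 (n - 1),
      LinearMap.ker (A ^ k * B ^ l - B ^ l * A ^ k).mulVecLin) ↔
    ∀ k l : ℕ, A ^ k ∈ commutingAt (B ^ l) x := by
  simp only [Submodule.mem_iInf, LinearMap.mem_ker, mulVecLin_apply, sub_mulVec, sub_eq_zero,
    ← mulVec_mulVec, Finset.mem_Icc]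
  refine ⟨fun h => pow_mem_commutingAt_pow fun k hk l hl => ?_, fun h k _ l _ => h k l⟩
  rw [Fintype.card_fin] at hk hl
  rcases k.eq_zero_or_pos with rfl | hk0
  · simp [mem_commutingAt]
  rcases l.eq_zero_or_pos with rfl | hl0
  · simp [mem_commutingAt]
  exact h k ⟨hk0, Nat.le_sub_one_of_lt hk⟩ l ⟨hl0, Nat.le_sub_one_of_lt hl⟩

/-- Properties of the Shemesh subspace `M = ⋂_{k,l=1}^{n-1} ker [A^k, B^l]`:
it is invariant under `A` and `B`, the matrices `A` and `B` commute on it, and it contains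
every common eigenvector of `A` and `B`. -/
theorem shemesh_subspace_properties (n : ℕ) (hn : 1 ≤ n) (A B : Matrix (Fin n) (Fin n) ℂ)
    (M : Submodule ℂ (Fin n → ℂ))
    (hM : M = ⨅ k ∈ Finset.Icc 1 (n - 1), ⨅ l ∈ Finset.Icc 1 (n - 1),
      LinearMap.ker (A ^ k * B ^ l - B ^ l * A ^ k).mulVecLin) :
    (∀ x ∈ M, A.mulVec x ∈ M) ∧ (∀ x ∈ M, B.mulVec x ∈ M) ∧
    (∀ x ∈ M, A.mulVec (B.mulVec x) = B.mulVec (A.mulVec x)) ∧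
    (∀ v : Fin n → ℂ, v ≠ 0 → (∃ α : ℂ, A.mulVec v = α • v) → (∃ β : ℂ, B.mulVec v = β • v) →
      v ∈ M) := by
  simp only [hM, mem_shemesh_subspace_iff]
  refine ⟨fun x hx => Matrix.pow_mem_commutingAt_pow_mulVec hx, fun x hx k l => ?_,
    fun x hx => by simpa [Matrix.mem_commutingAt] using hx 1 1, ?_⟩
  · exact Matrix.mem_commutingAt_comm.mp (Matrix.pow_mem_commutingAt_pow_mulVec
      (fun i j => Matrix.mem_commutingAt_comm.mp (hx j i)) l k)
  · rintro v - ⟨α, hα⟩ ⟨β, hβ⟩ k l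
    rw [Matrix.mem_commutingAt, Matrix.pow_mulVec_of_mulVec_eq_smul_s1 hα,
      Matrix.pow_mulVec_of_mulVec_eq_smul_s1 hβ, Matrix.mulVec_smul, Matrix.mulVec_smul,
      Matrix.pow_mulVec_of_mulVec_eq_smul_s1 hα, Matrix.pow_mulVec_of_mulVec_eq_smul_s1 hβ, smul_comm]
end

section
/- (Amitsur–Levitzki) For every n ≥ 1 and all matrices A_1, …, A_{2n} ∈ M_n(ℂ), the standard polynomial of order 2n vanishes: S_{2n}(A_1, …, A_{2n}) = 0. -/
namespace Matrix

open Polynomial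

/-- Jacobi's formula for the characteristic polynomial. -/
theorem derivative_charpoly {n R : Type*} [Fintype n] [DecidableEq n] [CommRing R]
    (M : Matrix n n R) : derivative M.charpoly = M.charmatrix.adjugate.trace := by
  have hadj (i : n) : M.charmatrix.adjugate i i = ∑ σ : Equiv.Perm n,
      ((Equiv.Perm.sign σ : ℤ) : R[X]) * ((∏ j ∈ Finset.univ.erase i, M.charmatrix j (σ j)) *
        derivative (M.charmatrix i (σ i))) := by
    rw [adjugate_apply, ← det_transpose, det_apply']
    refine Finset.sum_congr rfl fun σ _ => ?_
    rw [← Finset.prod_erase_mul _ _ (Finset.mem_univ i)]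
    congr 2
    · refine Finset.prod_congr rfl fun j hj => ?_
      rw [transpose_apply, updateRow_ne (Finset.ne_of_mem_erase hj)]
    · rcases eq_or_ne (σ i) i with h | h
      · simp [h]
      · simp [h, charmatrix_apply_ne _ _ _ h.symm]
  simp_rw [trace, diag_apply, hadj]
  rw [Finset.sum_comm, charpoly, ← det_transpose, det_apply', derivative_sum]
  refine Finset.sum_congr rfl fun σ _ => ?_
  rw [← Finset.mul_sum, ← derivative_prod_finset]
  simp [transpose_apply]

theorem trace_mul_adjugate_charmatrix_eq_zero {n R : Type*} [Fintype n] [DecidableEq n] [CommRing R]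
    (M : Matrix n n R) (hM : ∀ k, (M ^ (k + 1)).trace = 0) :
    (M.map C * M.charmatrix.adjugate).trace = 0 := by
  have htrace (k : ℕ) : ((M.map C) ^ (k + 1)).trace = 0 := by
    have := congrArg C (hM k)
    rw [map_zero, ← RingHom.mapMatrix_apply, ← map_pow] at *
    simpa [AddMonoidHom.map_trace] using this
  have hstep (k : ℕ) : ((M.map C) ^ (k + 1) * M.charmatrix.adjugate).trace =
      X ^ k * (M.map C * M.charmatrix.adjugate).trace := by
    induction k with
    | zero => simp
    | succ k ih =>
      have h : (M.map C) ^ (k + 1) * (M.charmatrix * M.charmatrix.adjugate) =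
          (X : R[X]) • ((M.map C) ^ (k + 1) * M.charmatrix.adjugate) -
            (M.map C) ^ (k + 2) * M.charmatrix.adjugate := by
        rw [charmatrix, scalar_apply, ← smul_one_eq_diagonal, sub_mul, mul_sub, pow_succ _ (k + 1)]
        simp [mul_assoc]
      rw [mul_adjugate, mul_smul_comm, mul_one] at h
      have h' := congrArg trace h
      rw [trace_smul, htrace, trace_sub, trace_smul, ih] at h'
      simp only [smul_eq_mul, mul_zero] at h'
      linear_combination h'
  have hcayley : ∑ k ∈ Finset.range (M.charpoly.natDegree + 1),
      C (M.charpoly.coeff k) • (M.map C) ^ k = (0 : Matrix n n R[X]) := by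
    have := congrArg (C : R →+* R[X]).mapMatrix M.aeval_self_charpoly
    rw [aeval_eq_sum_range, map_sum, map_zero] at this
    rw [← this]
    refine Finset.sum_congr rfl fun k _ => ?_
    rw [← RingHom.mapMatrix_apply, ← map_pow]
    ext : 2
    simp
  have h := congrArg (fun Y => (Y * (M.map C * M.charmatrix.adjugate)).trace) hcayley
  simp only [Finset.sum_mul, trace_sum, smul_mul_assoc, trace_smul, ← mul_assoc, ← pow_succ,
    hstep, zero_mul, trace_zero, smul_eq_mul] at h
  rw [← Finset.sum_mul, ← as_sum_range_C_mul_X_pow] at h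
  exact (M.charpoly_monic.mul_right_eq_zero_iff).1 h

/-- In characteristic zero, a matrix over a commutative algebra all of whose positive powers have
zero trace is nilpotent. -/
theorem pow_card_eq_zero_of_trace_pow_eq_zero (K : Type*) {n R : Type*} [Field K] [CharZero K]
    [Fintype n] [DecidableEq n] [CommRing R] [Algebra K R] (M : Matrix n n R)
    (hM : ∀ k, (M ^ (k + 1)).trace = 0) : M ^ Fintype.card n = 0 := by
  nontriviality R
  have hode : X * derivative M.charpoly = (Fintype.card n : R[X]) * M.charpoly := by
    have h := congrArg trace (M.charmatrix.mul_adjugate)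
    have hchar : M.charmatrix = (X : R[X]) • 1 - M.map C := by
      rw [charmatrix, scalar_apply, smul_one_eq_diagonal, RingHom.mapMatrix_apply]
    nth_rw 1 [hchar] at h
    rw [sub_mul, trace_sub,
      trace_mul_adjugate_charmatrix_eq_zero M hM, smul_mul_assoc, trace_smul, one_mul,
      ← derivative_charpoly, trace_smul, trace_one, sub_zero, smul_eq_mul, smul_eq_mul] at h
    rw [h, charpoly, mul_comm]
  have hcoeff (k : ℕ) (hk : k ≠ Fintype.card n) : M.charpoly.coeff k = 0 := by
    have h := congrArg (coeff · k) hode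
    simp only [coeff_natCast_mul] at h
    have h' : ((k : K) - Fintype.card n) • M.charpoly.coeff k = 0 := by
      rw [Algebra.smul_def]
      cases k with
      | zero => simp at h ⊢; linear_combination -h
      | succ k =>
        rw [coeff_X_mul, coeff_derivative] at h
        simp at h ⊢
        linear_combination h
    exact (smul_eq_zero_iff_right (sub_ne_zero.2 (by exact_mod_cast hk))).1 h'
  have hcharpoly : M.charpoly = X ^ Fintype.card n := by
    ext k
    rw [coeff_X_pow]
    split_ifs with hk
    · have := M.charpoly_monic.coeff_natDegree
      rwa [charpoly_natDegree_eq_dim, ← hk] at this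
    · exact hcoeff k hk
  simpa [hcharpoly] using M.aeval_self_charpoly

section Anticommuting

variable {E ι : Type*} [Ring E] {x : ι → E}

theorem commute_of_mem_adjoin_mul {K : Type*} [Field K] [Algebra K E]
    (hx : ∀ i j, x i * x j = -(x j * x i)) (i : ι) {c : E}
    (hc : c ∈ Algebra.adjoin K (Set.range fun p : ι × ι => x p.1 * x p.2)) :
    Commute (x i) c := by
  have hle : Algebra.adjoin K (Set.range fun p : ι × ι => x p.1 * x p.2) ≤
      Subalgebra.centralizer K {x i} := by
    rw [Algebra.adjoin_le_iff]
    rintro _ ⟨⟨a, b⟩, rfl⟩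
    rw [SetLike.mem_coe, Subalgebra.mem_centralizer_iff]
    rintro _ rfl
    dsimp only
    rw [← mul_assoc, hx i a, neg_mul, mul_assoc, hx i b, mul_neg, neg_neg, mul_assoc]
  exact Subalgebra.mem_centralizer_iff K |>.1 (hle hc) _ rfl

theorem isMulCommutative_adjoin_mul {K : Type*} [Field K] [Algebra K E]
    (hx : ∀ i j, x i * x j = -(x j * x i)) :
    IsMulCommutative (Algebra.adjoin K (Set.range fun p : ι × ι => x p.1 * x p.2)) := by
  refine Algebra.isMulCommutative_adjoin K ?_
  rintro _ ⟨⟨a, b⟩, rfl⟩ c hc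
  have h (i : ι) := commute_of_mem_adjoin_mul hx i (Algebra.subset_adjoin (R := K) hc)
  exact (h a).mul_left (h b)

theorem trace_mul_eq_neg_of_anticommute {n : Type*} [Fintype n] {Y Z : Matrix n n E}
    (h : ∀ i j, Y i j * Z j i = -(Z j i * Y i j)) : (Y * Z).trace = -(Z * Y).trace := by
  simp only [trace, diag_apply, mul_apply, h, Finset.sum_neg_distrib]
  rw [Finset.sum_comm]

theorem pow_two_mul_card_eq_zero_of_map_eq_sq (K : Type*) {S n : Type*} [Field K] [Algebra K E]
    [CharZero K] [CommRing S] [Algebra K S] [Fintype n] [DecidableEq n] {Y : Matrix n n E}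
    (hY : ∀ i j k l, Y i j * Y k l = -(Y k l * Y i j)) {φ : S →+* E} (hφ : Function.Injective φ)
    (hcomm : ∀ i j s, Commute (Y i j) (φ s)) {M : Matrix n n S} (hM : φ.mapMatrix M = Y ^ 2) :
    Y ^ (2 * Fintype.card n) = 0 := by
  have htrace (k : ℕ) : (M ^ (k + 1)).trace = 0 := by
    apply hφ
    rw [map_zero, AddMonoidHom.map_trace, ← RingHom.mapMatrix_apply, map_pow, hM,
      pow_succ' (Y ^ 2), sq, mul_assoc, ← sq]
    have hanti : (Y * (Y * (Y ^ 2) ^ k)).trace = -((Y * (Y ^ 2) ^ k) * Y).trace := by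
      refine trace_mul_eq_neg_of_anticommute fun i j => ?_
      rw [mul_apply, Finset.mul_sum, Finset.sum_mul, ← Finset.sum_neg_distrib]
      refine Finset.sum_congr rfl fun l _ => ?_
      rw [← hM, ← map_pow, RingHom.mapMatrix_apply, map_apply, ← mul_assoc, hY, neg_mul, mul_assoc,
        mul_assoc, (hcomm i j _).eq]
    rw [mul_assoc Y _ Y, (((Commute.refl Y).pow_right 2).pow_right k).symm.eq] at hanti
    refine (smul_eq_zero_iff_right (two_ne_zero (α := K))).1 ?_
    rw [two_smul, ← eq_neg_iff_add_eq_zero]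
    exact hanti
  rw [pow_mul, ← hM, ← map_pow, pow_card_eq_zero_of_trace_pow_eq_zero K M htrace, map_zero]

/-- A square matrix with pairwise anticommuting entries has vanishing `2 * card n`-th power. -/
theorem pow_two_mul_card_eq_zero_of_anticommute (K : Type*) [Field K] [Algebra K E] [CharZero K]
    {n : Type*} [Fintype n] [DecidableEq n] (Y : Matrix n n E)
    (hY : ∀ i j k l, Y i j * Y k l = -(Y k l * Y i j)) : Y ^ (2 * Fintype.card n) = 0 := by
  obtain ⟨x, hxY⟩ : ∃ x : n × n → E, ∀ i j, x (i, j) = Y i j :=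
    ⟨fun p => Y p.1 p.2, fun _ _ => rfl⟩
  have hx (p q : n × n) : x p * x q = -(x q * x p) := by
    simpa only [← hxY] using hY p.1 p.2 q.1 q.2
  obtain ⟨S, hS⟩ : ∃ S : Subalgebra K E,
      S = Algebra.adjoin K (Set.range fun p : (n × n) × (n × n) => x p.1 * x p.2) := ⟨_, rfl⟩
  have hScomm : IsMulCommutative S := hS ▸ isMulCommutative_adjoin_mul hx
  have hmem (i j : n) : (Y ^ 2) i j ∈ S := by
    rw [sq, mul_apply, hS]
    exact sum_mem fun k _ => Algebra.subset_adjoin ⟨((i, k), (k, j)), by simp only [hxY]⟩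
  let _ : CommRing S := { S.toRing with mul_comm := hScomm.is_comm.comm }
  obtain ⟨M, hM⟩ : ∃ M : Matrix n n S, S.val.toRingHom.mapMatrix M = Y ^ 2 :=
    ⟨of fun i j => ⟨(Y ^ 2) i j, hmem i j⟩, rfl⟩
  refine pow_two_mul_card_eq_zero_of_map_eq_sq K hY Subtype.val_injective (fun i j s => ?_) hM
  rw [← hxY]
  exact commute_of_mem_adjoin_mul hx (i, j) (hS.le s.2)

end Anticommuting

section Standard

open ExteriorAlgebra

theorem list_prod_map_smul {n α K E : Type*} [Fintype n] [DecidableEq n] [CommRing K] [Ring E]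
    [Algebra K E] (A : α → Matrix n n K) (x : α → E) (l : List α) :
    (l.map fun i => (A i).map fun c => c • x i).prod =
      ((l.map A).prod).map fun c => c • (l.map x).prod := by
  induction l with
  | nil => ext i j; simp [one_apply]
  | cons a l ih =>
    ext i j
    simp [ih, mul_apply, Finset.sum_smul, smul_smul, mul_comm]

theorem exists_linearMap_ιMulti_eq_det (K : Type*) [Field K] (m : ℕ) :
    ∃ L : ExteriorAlgebra K (Fin m → K) →ₗ[K] K,
      ∀ v : Fin m → Fin m → K, L (ιMulti K m v) = det (of v) := by
  refine ⟨liftAlternating (Pi.single m detRowAlternating), fun v => ?_⟩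
  rw [liftAlternating_apply_ιMulti, Pi.single_eq_same]
  rfl

/-- The Amitsur–Levitzki theorem over a field of characteristic zero. -/
theorem sum_sign_smul_prod_eq_zero {K n : Type*} [Field K] [CharZero K] [Fintype n]
    [DecidableEq n] {m : ℕ} (hm : m = 2 * Fintype.card n) (A : Fin m → Matrix n n K) :
    ∑ σ : Equiv.Perm (Fin m),
      ((Equiv.Perm.sign σ : ℤ) • (List.ofFn fun i => A (σ i)).prod) = 0 := by
  let e : Fin m → Fin m → K := fun i => Pi.single i 1
  let B : Matrix n n (Fin m → K) := of fun a b => ∑ i, A i a b • e i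
  have hpow : (B.map (ι K)) ^ m = 0 := by
    have h := pow_two_mul_card_eq_zero_of_anticommute K (B.map (ι K)) fun _ _ _ _ =>
      eq_neg_of_add_eq_zero_left (ι_add_mul_swap _ _)
    rwa [← hm] at h
  have hB : B.map (ι K) = ∑ i, (A i).map fun c => c • ι K (e i) := by
    ext a b
    simp [B, sum_apply]
  have hexpand : (B.map (ι K)) ^ m = ∑ f : Fin m → Fin m,
      ((List.ofFn fun i => A (f i)).prod).map fun c => c • ιMulti K m (fun i => e (f i)) := by
    have h := (MultilinearMap.mkPiAlgebraFin ℤ m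
      (Matrix n n (ExteriorAlgebra K (Fin m → K)))).map_sum
      (fun (_ : Fin m) (i : Fin m) => (A i).map fun c => c • ι K (e i))
    simp only [MultilinearMap.mkPiAlgebraFin_apply, ← hB, List.ofFn_const, List.prod_replicate] at h
    rw [h]
    refine Finset.sum_congr rfl fun f _ => ?_
    have h' := list_prod_map_smul A (fun i => ι K (e i)) (List.ofFn f)
    simp only [List.map_ofFn, Function.comp_def] at h'
    rw [h', ιMulti_apply]
  obtain ⟨L, hL⟩ := exists_linearMap_ιMulti_eq_det K m
  have hperm (σ : Equiv.Perm (Fin m)) : det (of fun i => e (σ i)) = (Equiv.Perm.sign σ : ℤ) := by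
    have := det_permute σ (1 : Matrix (Fin m) (Fin m) K)
    rw [det_one, mul_one] at this
    rw [← this]
    congr 1
    ext i j
    simp [e, Pi.single_apply, one_apply, eq_comm]
  ext a b
  have h := congrArg L (congrFun₂ (hexpand.symm.trans hpow) a b)
  rw [sum_apply, map_sum, zero_apply, map_zero] at h
  simp only [map_apply, map_smul, hL, smul_eq_mul] at h
  rw [zero_apply, ← h, sum_apply]
  refine Finset.sum_of_injOn (fun σ => ⇑σ) DFunLike.coe_injective.injOn (fun _ _ => by simp) ?_ ?_
  · intro f _ hf
    have hinj : ¬ Function.Injective f := fun hf' =>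
      hf ⟨Equiv.ofBijective f (Finite.injective_iff_bijective.1 hf'), by simp, rfl⟩
    simp only [Function.Injective, not_forall] at hinj
    obtain ⟨i, j, hij, hne⟩ := hinj
    rw [det_zero_of_row_eq hne (congrArg e hij :), mul_zero]
  · intro σ _
    rw [hperm, smul_apply, zsmul_eq_mul, mul_comm]

end Standard

end Matrix

/-- **Amitsur–Levitzki theorem.** For every `n ≥ 1` and all matrices
`A_1, …, A_{2n} ∈ M_n(ℂ)`, the standard polynomial of order `2n` vanishes:
`S_{2n}(A_1, …, A_{2n}) = ∑_{σ} sign(σ) A_{σ(1)} ⋯ A_{σ(2n)} = 0`. -/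
theorem amitsur_levitzki (n : ℕ) (hn : 1 ≤ n) (A : Fin (2 * n) → Matrix (Fin n) (Fin n) ℂ) :
    ∑ σ : Equiv.Perm (Fin (2 * n)),
      ((Equiv.Perm.sign σ : ℤ) • (List.ofFn fun i => A (σ i)).prod) = 0 := by
  exact Matrix.sum_sign_smul_prod_eq_zero (by simp) A
end

section
/- For every n ≥ 1 there exist matrices A_1, …, A_{2n-1} ∈ M_n(ℂ) such that S_{2n-1}(A_1, …, A_{2n-1}) ≠ 0; that is, the full matrix algebra M_n(ℂ) satisfies no standard polynomial identity of order smaller than 2n. -/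
namespace Matrix

variable {ι R : Type*} [Fintype ι] [DecidableEq ι] [Semiring R]

/-- A product of matrix units along a path is the matrix unit joining the endpoints. -/
lemma prod_ofFn_single_of_chain : ∀ {m : ℕ} (a b : Fin (m + 1) → ι),
    (∀ i : Fin m, b i.castSucc = a i.succ) →
      (List.ofFn fun i => single (a i) (b i) (1 : R)).prod = single (a 0) (b (Fin.last m)) 1
  | 0, a, b, _ => by simp
  | m + 1, a, b, h => by
    have ih := prod_ofFn_single_of_chain (fun i => a i.succ) (fun i => b i.succ)
      fun i => by simpa using h i.succ
    have h0 : b 0 = a (Fin.succ 0) := h 0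
    rw [List.ofFn_succ, List.prod_cons, ih, h0, single_mul_single_same, one_mul, Fin.succ_last]

/-- A product of matrix units vanishes as soon as two consecutive factors do not match. -/
lemma prod_ofFn_single_eq_zero : ∀ {m : ℕ} (a b : Fin (m + 1) → ι) (i : Fin m),
    b i.castSucc ≠ a i.succ → (List.ofFn fun i => single (a i) (b i) (1 : R)).prod = 0
  | m + 1, a, b, i, h => by
    induction i using Fin.cases with
    | zero =>
      have h0 : b 0 ≠ a (Fin.succ 0) := h
      rw [List.ofFn_succ, List.prod_cons, List.ofFn_succ, List.prod_cons, ← mul_assoc,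
        single_mul_single_of_ne (h := h0), zero_mul]
    | succ j =>
      rw [List.ofFn_succ, List.prod_cons,
        prod_ofFn_single_eq_zero (fun i => a i.succ) (fun i => b i.succ) j (by simpa using h),
        mul_zero]

end Matrix

/-- The only permutation of `Fin (m + 1)` that is strictly increasing is the identity. -/
lemma Equiv.Perm.eq_one_of_forall_castSucc_lt_succ {m : ℕ} (σ : Equiv.Perm (Fin (m + 1)))
    (h : ∀ i : Fin m, σ i.castSucc < σ i.succ) : σ = 1 := by
  have hmono : StrictMono σ := Fin.strictMono_iff_lt_succ.2 h
  ext1 i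
  exact congrFun ((hmono.range_inj strictMono_id).1 (by simp [σ.surjective.range_eq])) i

/-- `M_n(ℂ)` satisfies no standard polynomial identity of order smaller than `2n`:
for every `n ≥ 1` there exist matrices `A_1, …, A_{2n-1} ∈ M_n(ℂ)` with
`S_{2n-1}(A_1, …, A_{2n-1}) ≠ 0`. -/
theorem no_standard_identity_below_two_n (n : ℕ) (hn : 1 ≤ n) :
    ∃ A : Fin (2 * n - 1) → Matrix (Fin n) (Fin n) ℂ,
      ∑ σ : Equiv.Perm (Fin (2 * n - 1)),
        ((Equiv.Perm.sign σ : ℤ) • (List.ofFn fun i => A (σ i)).prod) ≠ 0 := by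
  obtain ⟨k, rfl⟩ := Nat.exists_eq_add_of_le' hn
  change ∃ A : Fin (2 * k + 1) → Matrix (Fin (k + 1)) (Fin (k + 1)) ℂ,
      ∑ σ : Equiv.Perm (Fin (2 * k + 1)),
        ((Equiv.Perm.sign σ : ℤ) • (List.ofFn fun i => A (σ i)).prod) ≠ 0
  -- The staircase `E₁₁, E₁₂, E₂₂, E₂₃, …, Eₙₙ`: only the identity ordering has nonzero product.
  let a : Fin (2 * k + 1) → Fin (k + 1) := fun i => ⟨i / 2, by omega⟩
  let b : Fin (2 * k + 1) → Fin (k + 1) := fun i => ⟨(i + 1) / 2, by omega⟩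
  refine ⟨fun i => Matrix.single (a i) (b i) 1, ?_⟩
  rw [Finset.sum_eq_single 1]
  · have hchain := Matrix.prod_ofFn_single_of_chain (R := ℂ) a b fun i => by simp [a, b]
    simp only [Equiv.Perm.sign_one, Units.val_one, one_smul, Equiv.Perm.one_apply, hchain]
    exact fun h => by simpa using congrFun₂ h (a 0) (b (Fin.last _))
  · intro σ _ hσ
    obtain ⟨i, hi⟩ : ∃ i : Fin (2 * k), b (σ i.castSucc) ≠ a (σ i.succ) := by
      by_contra! hall
      refine hσ (σ.eq_one_of_forall_castSucc_lt_succ fun i => ?_)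
      have hne : (σ i.castSucc : ℕ) ≠ σ i.succ := fun h =>
        Fin.castSucc_lt_succ.ne (σ.injective (Fin.ext h))
      have hab : ((σ i.castSucc : ℕ) + 1) / 2 = (σ i.succ : ℕ) / 2 := congrArg Fin.val (hall i)
      rw [Fin.lt_def]
      omega
    rw [Matrix.prod_ofFn_single_eq_zero (fun i => a (σ i)) (fun i => b (σ i)) i hi, smul_zero]
  · simp
end

section
/- Let U, V ∈ M_n(ℂ) be unitary matrices. Then the standard polynomial of order 4 evaluated at (U, V, U†, V†) satisfies S_4(U, V, U†, V†) = W + W†, where W = U V U† V† − U† V U V† + U† V† U V − U V† U† V. -/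
open Matrix

/-- The sum over all permutations of `Fin (n + 1)`, split by the image of `0`. -/
theorem sum_perm_fin_succ {M : Type*} [AddCommMonoid M] {n : ℕ}
    (f : Equiv.Perm (Fin (n + 1)) → M) :
    ∑ σ, f σ = ∑ p : Fin (n + 1), ∑ e : Equiv.Perm (Fin n),
      f (Equiv.Perm.decomposeFin.symm (p, e)) := by
  rw [← Equiv.Perm.decomposeFin.symm.sum_comp, Fintype.sum_prod_type]

/-- The standard polynomial of order 4 at `(a, b, c, d)`, when `a, c` and `b, d` are
mutually inverse pairs. -/
theorem standard_poly_four_of_inverses {R : Type*} [Ring R] (a b c d : R)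
    (hac : a * c = 1) (hca : c * a = 1) (hbd : b * d = 1) (hdb : d * b = 1) :
    ∑ σ : Equiv.Perm (Fin 4),
        ((Equiv.Perm.sign σ : ℤ) • (List.ofFn fun i => ![a, b, c, d] (σ i)).prod) =
      (a * b * c * d - c * b * a * d + c * d * a * b - a * d * c * b) +
        (b * a * d * c - b * c * d * a + d * c * b * a - d * a * b * c) := by
  have hac' (x : R) : a * (c * x) = x := by rw [← mul_assoc, hac, one_mul]
  have hca' (x : R) : c * (a * x) = x := by rw [← mul_assoc, hca, one_mul]
  have hbd' (x : R) : b * (d * x) = x := by rw [← mul_assoc, hbd, one_mul]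
  have hdb' (x : R) : d * (b * x) = x := by rw [← mul_assoc, hdb, one_mul]
  simp only [sum_perm_fin_succ, Finset.univ_unique, Finset.sum_singleton,
    Equiv.Perm.decomposeFin.symm_sign, List.ofFn_succ, List.ofFn_zero, List.prod_cons,
    List.prod_nil, Equiv.Perm.decomposeFin_symm_apply_zero,
    Equiv.Perm.decomposeFin_symm_apply_succ]
  simp [Fin.sum_univ_four, Fin.sum_univ_three, Equiv.swap_apply_def, mul_assoc, hac, hca, hbd,
    hdb, hac', hca', hbd', hdb']
  abel

/-- For unitary matrices `U, V ∈ M_n(ℂ)`, the standard polynomial of order 4 satisfies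
`S_4(U, V, U†, V†) = W + W†` with
`W = U V U† V† − U† V U V† + U† V† U V − U V† U† V`. -/
theorem standard_poly_four_of_unitaries (n : ℕ) (U V : Matrix (Fin n) (Fin n) ℂ)
    (hU : U ∈ Matrix.unitaryGroup (Fin n) ℂ) (hV : V ∈ Matrix.unitaryGroup (Fin n) ℂ) :
    ∑ σ : Equiv.Perm (Fin 4),
        ((Equiv.Perm.sign σ : ℤ) • (List.ofFn fun i => ![U, V, Uᴴ, Vᴴ] (σ i)).prod) =
      (U * V * Uᴴ * Vᴴ - Uᴴ * V * U * Vᴴ + Uᴴ * Vᴴ * U * V - U * Vᴴ * Uᴴ * V) +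
        (U * V * Uᴴ * Vᴴ - Uᴴ * V * U * Vᴴ + Uᴴ * Vᴴ * U * V - U * Vᴴ * Uᴴ * V)ᴴ := by
  rw [standard_poly_four_of_inverses U V Uᴴ Vᴴ (Matrix.mem_unitaryGroup_iff.mp hU)
    (Matrix.mem_unitaryGroup_iff'.mp hU) (Matrix.mem_unitaryGroup_iff.mp hV)
    (Matrix.mem_unitaryGroup_iff'.mp hV)]
  simp only [conjTranspose_add, conjTranspose_sub, conjTranspose_mul,
    conjTranspose_conjTranspose, mul_assoc]
end
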